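/- arXiv:2111.13037 — 2 statements merged into one kernel-verified Lean document; each statement's English description precedes it below -/
import Mathlib

section
/- Let A be an N×N real symmetric positive definite matrix, Y ∈ ℝ^N, and S ⊆ {1,…,N} an index subset. Let A_S denote the principal submatrix of A with rows and columns indexed by S (which is also positive definite) and Y_S the subvector of Y indexed by S. Then Y_Sᵀ (A_S)^{-1} Y_S ≤ Yᵀ A^{-1} Y. -/
open Matrix

/-- The inverse quadratic form at `Y` bounds `2 xᵀY - xᵀAx` for every `x`. -/
theorem two_mul_dotProduct_sub_le_inv_quadratic_form {n : Type*} [Fintype n] [DecidableEq n]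
    {A : Matrix n n ℝ} (hA : A.PosDef) (x Y : n → ℝ) :
    2 * (x ⬝ᵥ Y) - x ⬝ᵥ (A *ᵥ x) ≤ Y ⬝ᵥ (A⁻¹ *ᵥ Y) := by
  have hdet : IsUnit A.det := (isUnit_iff_isUnit_det A).mp hA.isUnit
  have hAinv : A *ᵥ (A⁻¹ *ᵥ Y) = Y := by
    rw [mulVec_mulVec, mul_nonsing_inv _ hdet, one_mulVec]
  have hsymm : (A⁻¹ *ᵥ Y) ⬝ᵥ (A *ᵥ x) = x ⬝ᵥ Y := by
    have hT : Aᵀ = A := by simpa [IsHermitian, conjTranspose_eq_transpose_of_trivial] using hA.1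
    rw [dotProduct_mulVec, ← mulVec_transpose, hT, hAinv, dotProduct_comm]
  have hnonneg := hA.posSemidef.dotProduct_mulVec_nonneg (x - A⁻¹ *ᵥ Y)
  rw [star_trivial, mulVec_sub, hAinv, sub_dotProduct, dotProduct_sub, dotProduct_sub, hsymm,
    dotProduct_comm (A⁻¹ *ᵥ Y) Y] at hnonneg
  linarith

/-- Composing with an injection `e` does not increase the inverse quadratic form. -/
theorem submatrix_inv_quadratic_form_le {m n : Type*} [Fintype m] [DecidableEq m]
    [Fintype n] [DecidableEq n] {A : Matrix n n ℝ} (hA : A.PosDef) {e : m → n}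
    (he : Function.Injective e) (Y : n → ℝ) :
    (Y ∘ e) ⬝ᵥ ((A.submatrix e e)⁻¹ *ᵥ (Y ∘ e)) ≤ Y ⬝ᵥ (A⁻¹ *ᵥ Y) := by
  set B := A.submatrix e e
  set z := B⁻¹ *ᵥ (Y ∘ e) with hz
  let P : Matrix n m ℝ := (1 : Matrix n n ℝ).submatrix id e
  have hBz : B *ᵥ z = Y ∘ e := by
    rw [hz, mulVec_mulVec,
      mul_nonsing_inv _ ((isUnit_iff_isUnit_det B).mp (hA.submatrix he).isUnit), one_mulVec]
  have hP (v : n → ℝ) : (P *ᵥ z) ⬝ᵥ v = z ⬝ᵥ (v ∘ e) := by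
    rw [dotProduct_comm, dotProduct_mulVec, dotProduct_comm]
    congr 1
    ext i
    simp [P, vecMul, dotProduct, one_apply]
  have hAP : (A *ᵥ (P *ᵥ z)) ∘ e = B *ᵥ z := by
    have hmul : A * P = A.submatrix id e := by
      ext i j
      simp [P, mul_apply, one_apply]
    rw [mulVec_mulVec, hmul]
    rfl
  have hmax := two_mul_dotProduct_sub_le_inv_quadratic_form hA (P *ᵥ z) Y
  rw [hP, hP, hAP, hBz] at hmax
  rw [dotProduct_comm]
  linarith

/-- **Monotonicity of the inverse quadratic form under taking principal submatrices.**
If `A` is an `N × N` real symmetric positive definite matrix, `Y ∈ ℝ^N`, and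
`S ⊆ {1,…,N}`, then `Y_Sᵀ (A_S)⁻¹ Y_S ≤ Yᵀ A⁻¹ Y`, where `A_S` is the principal
submatrix of `A` indexed by `S` and `Y_S` the corresponding subvector of `Y`. -/
theorem principal_submatrix_inverse_quadratic_form_le
    {N : ℕ} (A : Matrix (Fin N) (Fin N) ℝ) (hA : A.PosDef)
    (Y : Fin N → ℝ) (S : Finset (Fin N)) :
    (fun i : S => Y i) ⬝ᵥ
        ((A.submatrix (Subtype.val : S → Fin N) Subtype.val)⁻¹ *ᵥ fun i : S => Y i)
      ≤ Y ⬝ᵥ (A⁻¹ *ᵥ Y) := by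
  exact submatrix_inv_quadratic_form_le hA Subtype.val_injective Y
end

section
/- (The Kernel Flows loss ρ lies in [0,1].) Let Θ be an M×M real symmetric positive semidefinite matrix, λ > 0, Y ∈ ℝ^M with Y ≠ 0, and let S ⊆ {1,…,M}. Let Θ_S be the principal submatrix of Θ indexed by S, I the identity of appropriate size, and Y_S the subvector of Y indexed by S. Then the quantity ρ := 1 − (Y_Sᵀ (Θ_S + λI)^{-1} Y_S) / (Yᵀ (Θ + λI)^{-1} Y) is well defined (the denominator is strictly positive) and satisfies 0 ≤ ρ ≤ 1. -/
open Matrix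

/-- The quadratic form of `A⁻¹` is the Legendre dual of that of a positive definite `A`. -/
lemma Matrix.PosDef.two_mul_dotProduct_sub_le {n : Type*} [Fintype n] [DecidableEq n]
    {A : Matrix n n ℝ} (hA : A.PosDef) (v y : n → ℝ) :
    2 * (v ⬝ᵥ y) - v ⬝ᵥ (A *ᵥ v) ≤ y ⬝ᵥ (A⁻¹ *ᵥ y) := by
  have hdet : IsUnit A.det := (isUnit_iff_isUnit_det A).1 hA.isUnit
  have hAu : A *ᵥ (A⁻¹ *ᵥ y) = y := by
    rw [mulVec_mulVec, mul_nonsing_inv A hdet, one_mulVec]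
  have hsymm : (A⁻¹ *ᵥ y) ⬝ᵥ (A *ᵥ v) = v ⬝ᵥ y := by
    have hT : Aᵀ = A := by simpa using hA.isHermitian.eq
    rw [dotProduct_mulVec, ← mulVec_transpose, hT, hAu, dotProduct_comm]
  have h := hA.posSemidef.dotProduct_mulVec_nonneg (A⁻¹ *ᵥ y - v)
  rw [star_trivial, mulVec_sub, hAu, sub_dotProduct, dotProduct_sub, dotProduct_sub, hsymm,
    dotProduct_comm (A⁻¹ *ᵥ y) y] at h
  linarith

/-- Restricting a positive definite matrix and a vector to a subset of the indices does not
increase the value of the inverse quadratic form. -/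
lemma Matrix.PosDef.dotProduct_inv_submatrix_mulVec_le {m n : Type*} [Fintype m] [DecidableEq m]
    [Fintype n] [DecidableEq n] {A : Matrix n n ℝ} (hA : A.PosDef) {e : m → n}
    (he : Function.Injective e) (y : n → ℝ) :
    (y ∘ e) ⬝ᵥ ((A.submatrix e e)⁻¹ *ᵥ (y ∘ e)) ≤ y ⬝ᵥ (A⁻¹ *ᵥ y) := by
  have hdet : IsUnit (A.submatrix e e).det :=
    (isUnit_iff_isUnit_det _).1 (hA.submatrix he).isUnit
  set w := (A.submatrix e e)⁻¹ *ᵥ (y ∘ e) with hw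
  have hBw : A.submatrix e e *ᵥ w = y ∘ e := by
    rw [hw, mulVec_mulVec, mul_nonsing_inv _ hdet, one_mulVec]
  set P : Matrix n m ℝ := (1 : Matrix n n ℝ).submatrix id e with hP
  have hPdot (x : n → ℝ) : (P *ᵥ w) ⬝ᵥ x = w ⬝ᵥ (x ∘ e) := by
    rw [dotProduct_comm, dotProduct_mulVec, dotProduct_comm]
    congr 1
    ext j
    simp [hP, vecMul, dotProduct, one_apply]
  have hAP : (A *ᵥ (P *ᵥ w)) ∘ e = A.submatrix e e *ᵥ w := by
    have hmul : A * P = A.submatrix id e := by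
      ext i j
      simp [hP, mul_apply, one_apply]
    rw [mulVec_mulVec, hmul]
    rfl
  have h := hA.two_mul_dotProduct_sub_le (P *ᵥ w) y
  rw [hPdot, hPdot, hAP, hBw] at h
  rw [dotProduct_comm]
  linarith

/-- **The Kernel Flows loss `ρ` lies in `[0,1]`.**
Let `Θ` be an `M × M` real symmetric positive semidefinite matrix, `λ > 0`, `Y ≠ 0`,
and `S ⊆ {1,…,M}`.  Then the denominator `Yᵀ (Θ + λI)⁻¹ Y` is strictly positive, and
`ρ := 1 − Y_Sᵀ (Θ_S + λI)⁻¹ Y_S / (Yᵀ (Θ + λI)⁻¹ Y)` satisfies `0 ≤ ρ ≤ 1`. -/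
theorem kernel_flows_rho_mem_unit_interval
    {M : ℕ} (Θ : Matrix (Fin M) (Fin M) ℝ) (hΘ : Θ.PosSemidef)
    (lam : ℝ) (hlam : 0 < lam) (Y : Fin M → ℝ) (hY : Y ≠ 0) (S : Finset (Fin M)) :
    0 < Y ⬝ᵥ ((Θ + lam • 1)⁻¹ *ᵥ Y) ∧
    0 ≤ 1 - ((fun i : S => Y i) ⬝ᵥ
          ((Θ.submatrix (Subtype.val : S → Fin M) Subtype.val + lam • 1)⁻¹ *ᵥ
            fun i : S => Y i)) / (Y ⬝ᵥ ((Θ + lam • 1)⁻¹ *ᵥ Y)) ∧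
    1 - ((fun i : S => Y i) ⬝ᵥ
          ((Θ.submatrix (Subtype.val : S → Fin M) Subtype.val + lam • 1)⁻¹ *ᵥ
            fun i : S => Y i)) / (Y ⬝ᵥ ((Θ + lam • 1)⁻¹ *ᵥ Y)) ≤ 1 := by
  have hA : (Θ + lam • (1 : Matrix (Fin M) (Fin M) ℝ)).PosDef :=
    PosDef.posSemidef_add hΘ (PosDef.one.smul hlam)
  have hpos : 0 < Y ⬝ᵥ ((Θ + lam • 1)⁻¹ *ᵥ Y) := by
    simpa using hA.inv.dotProduct_mulVec_pos hY
  have hsub : (Θ + lam • (1 : Matrix (Fin M) (Fin M) ℝ)).submatrix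
      (Subtype.val : S → Fin M) Subtype.val =
      Θ.submatrix (Subtype.val : S → Fin M) Subtype.val + lam • (1 : Matrix S S ℝ) := by
    rw [← submatrix_one (Subtype.val : S → Fin M) Subtype.val_injective]
    rfl
  have hle := hA.dotProduct_inv_submatrix_mulVec_le
    (Subtype.val_injective : Function.Injective (Subtype.val : S → Fin M)) Y
  have hnonneg := (hA.submatrix
    (Subtype.val_injective : Function.Injective (Subtype.val : S → Fin M))).inv.posSemidef
    |>.dotProduct_mulVec_nonneg (Y ∘ Subtype.val)
  rw [hsub] at hle hnonneg
  rw [star_trivial] at hnonneg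
  exact ⟨hpos, sub_nonneg.2 ((div_le_one hpos).2 hle),
    sub_le_self _ (div_nonneg hnonneg hpos.le)⟩
end
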